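/- arXiv:2110.11004 — 2 statements merged into one kernel-verified Lean document; each statement's English description precedes it below -/
import Mathlib

section
/- Let U, P be real inner product spaces, V := U × P, M ≥ 1, γ, η, η₀ ∈ ℝ, and χ_1, …, χ_M ∈ ℝ. Let J_1, …, J_M : V → ℝ and B_1, …, B_M : V → ℝ be linear maps (representing respectively the cost derivative J′_u(q(t_m), u(t_m))(·) and Φ ↦ k_m · a′_u(q(t_m), u(t_m))(Φ, z(t_m)), both linear in the test argument), and let z_{φ,0}, …, z_{φ,M} ∈ P and z_{u,0} ∈ U be the adjoint values. Then the following are equivalent: (i) for every test tuple (Φ_0, …, Φ_M) ∈ V^{M+1}: ∑_{m=1}^{M} J_m(Φ_m) − γ χ_M ⟨Φ_{φ,M}, z_{φ,M}⟩ − η ⟨Φ_{φ,M}, z_{φ,M}⟩ + ∑_{m=1}^{M} [γ χ_m ⟨Φ_{φ,m−1}, z_{φ,m} − z_{φ,m−1}⟩ + η ⟨Φ_{φ,m−1}, z_{φ,m} − z_{φ,m−1}⟩] − ∑_{m=1}^{M} B_m(Φ_m) − η₀ ⟨Φ_{u,0}, z_{u,0}⟩ = 0 (the global adjoint equation (23)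 set to zero); (ii) the terminal equation: for all Φ ∈ V, B_M(Φ) + γ χ_M ⟨Φ_φ, z_{φ,M}⟩ + η ⟨Φ_φ, z_{φ,M}⟩ = J_M(Φ); the backward steps for m = M−1, …, 1: for all Φ ∈ V, B_m(Φ) + γ χ_{m+1} ⟨Φ_φ, z_{φ,m} − z_{φ,m+1}⟩ + η ⟨Φ_φ, z_{φ,m} − z_{φ,m+1}⟩ = J_m(Φ); and the initial equation: for all Φ ∈ V, γ χ_1 ⟨Φ_φ, z_{φ,0} − z_{φ,1}⟩ + η ⟨Φ_φ, z_{φ,0} − z_{φ,1}⟩ + η₀ ⟨Φ_u, z_{u,0}⟩ = 0. (This is the equivalence between the variational adjoint equation and the backward-in-time adjoint time-stepping scheme, including the residual initial equation (24).) -/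
open RealInnerProductSpace

/-- A sum of functions vanishing at zero, each evaluated at its own test value, is zero for all
test sequences iff every summand vanishes identically. -/
theorem forall_add_sum_add_eq_zero_iff {V : Type*} [Zero V] (n : ℕ) (I T : V → ℝ) (S : ℕ → V → ℝ)
    (hI : I 0 = 0) (hT : T 0 = 0) (hS : ∀ i, S i 0 = 0) :
    (∀ Φ : ℕ → V, I (Φ 0) + ∑ i ∈ Finset.range n, S i (Φ (i + 1)) + T (Φ (n + 1)) = 0) ↔
      (∀ v, T v = 0) ∧ (∀ i < n, ∀ v, S i v = 0) ∧ ∀ v, I v = 0 := by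
  classical
  refine ⟨fun h => ⟨fun v => ?_, fun i hi v => ?_, fun v => ?_⟩, fun ⟨h₁, h₂, h₃⟩ Φ => ?_⟩
  · have key := h (Pi.single (n + 1) v)
    rw [Finset.sum_eq_zero] at key
    · simpa [hI] using key
    · intro j hj
      rw [Pi.single_eq_of_ne (by have := Finset.mem_range.1 hj; omega), hS]
  · have key := h (Pi.single (i + 1) v)
    rw [Finset.sum_eq_single_of_mem i (Finset.mem_range.2 hi)] at key
    · simpa [hI, hT, Pi.single_eq_of_ne (show n + 1 ≠ i + 1 by omega)] using key
    · intro j _ hj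
      rw [Pi.single_eq_of_ne (by omega), hS]
  · simpa [hT, hS] using h (Pi.single 0 v)
  · rw [h₁, h₃, Finset.sum_eq_zero fun i hi => h₂ i (Finset.mem_range.1 hi) _]
    simp

/-- Shift a sum over `{1, …, n + 1}` to one over `{0, …, n}`. -/
theorem sum_Icc_one_succ_eq_sum_range (f : ℕ → ℝ) (n : ℕ) :
    ∑ m ∈ Finset.Icc 1 (n + 1), f m = ∑ i ∈ Finset.range (n + 1), f (i + 1) := by
  rw [Finset.range_eq_Ico, Finset.sum_Ico_add' f 0 (n + 1) 1]
  rfl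

/-- Equivalence of the global variational adjoint equation (23) and the
backward adjoint time-stepping scheme, including the residual initial
equation (24). -/
theorem stmt_4 (U P : Type*) [NormedAddCommGroup U] [InnerProductSpace ℝ U]
    [NormedAddCommGroup P] [InnerProductSpace ℝ P]
    (M : ℕ) (hM : 1 ≤ M) (γ η η₀ : ℝ) (χ : ℕ → ℝ)
    (J B : ℕ → (U × P) →ₗ[ℝ] ℝ)
    (zφ : ℕ → P) (zu0 : U) :
    (∀ Φ : ℕ → U × P,
      (∑ m ∈ Finset.Icc 1 M, J m (Φ m))
        - γ * χ M * ⟪(Φ M).2, zφ M⟫ - η * ⟪(Φ M).2, zφ M⟫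
        + (∑ m ∈ Finset.Icc 1 M,
            (γ * χ m * ⟪(Φ (m - 1)).2, zφ m - zφ (m - 1)⟫
              + η * ⟪(Φ (m - 1)).2, zφ m - zφ (m - 1)⟫))
        - (∑ m ∈ Finset.Icc 1 M, B m (Φ m))
        - η₀ * ⟪(Φ 0).1, zu0⟫ = 0)
    ↔ ((∀ Φ : U × P,
          B M Φ + γ * χ M * ⟪Φ.2, zφ M⟫ + η * ⟪Φ.2, zφ M⟫ = J M Φ)
      ∧ (∀ m, 1 ≤ m → m < M → ∀ Φ : U × P,
          B m Φ + γ * χ (m + 1) * ⟪Φ.2, zφ m - zφ (m + 1)⟫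
            + η * ⟪Φ.2, zφ m - zφ (m + 1)⟫ = J m Φ)
      ∧ (∀ Φ : U × P,
          γ * χ 1 * ⟪Φ.2, zφ 0 - zφ 1⟫ + η * ⟪Φ.2, zφ 0 - zφ 1⟫
            + η₀ * ⟪Φ.1, zu0⟫ = 0)) := by
  obtain ⟨n, rfl⟩ : ∃ n, M = n + 1 := ⟨M - 1, by omega⟩
  have key := forall_add_sum_add_eq_zero_iff n
    (fun v : U × P => γ * χ 1 * ⟪v.2, zφ 1 - zφ 0⟫ + η * ⟪v.2, zφ 1 - zφ 0⟫ - η₀ * ⟪v.1, zu0⟫)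
    (fun v => J (n + 1) v - B (n + 1) v - γ * χ (n + 1) * ⟪v.2, zφ (n + 1)⟫
      - η * ⟪v.2, zφ (n + 1)⟫)
    (fun i v => J (i + 1) v - B (i + 1) v
      + (γ * χ (i + 2) * ⟪v.2, zφ (i + 2) - zφ (i + 1)⟫ + η * ⟪v.2, zφ (i + 2) - zφ (i + 1)⟫))
    (by simp) (by simp) (by simp)
  refine Iff.trans (forall_congr' fun Φ => ?_) (key.trans (and_congr ?_ (and_congr ?_ ?_)))
  · simp only [sum_Icc_one_succ_eq_sum_range, Nat.add_sub_cancel]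
    rw [Finset.sum_range_succ, Finset.sum_range_succ' (fun i => _ + _),
      Finset.sum_range_succ (fun i => B _ _), Finset.sum_add_distrib (f := fun i => _ - _),
      Finset.sum_sub_distrib]
    simp only [zero_add, add_assoc, Nat.reduceAdd]
    refine Eq.congr_left ?_
    ring
  · exact forall_congr' fun v => ⟨fun h => by linarith, fun h => by linarith⟩
  · constructor
    · intro h m hm hmn v
      obtain ⟨i, rfl⟩ : ∃ i, m = i + 1 := ⟨m - 1, by omega⟩
      have := h i (by omega) v
      rw [← neg_sub (zφ (i + 1 + 1)), inner_neg_right]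
      linarith
    · intro h i hi v
      have := h (i + 1) (by omega) (by omega) v
      rw [← neg_sub (zφ (i + 1 + 1)), inner_neg_right] at this
      linarith
  · refine forall_congr' fun v => ?_
    rw [← neg_sub (zφ 1), inner_neg_right]
    exact ⟨fun h => by linarith, fun h => by linarith⟩
end

section
/- Let U, P be real inner product spaces, V := U × P, M ≥ 1, γ ∈ ℝ, η > 0, η₀ > 0, and χ_1, …, χ_M ∈ ℝ. Let A_1, …, A_M : V → ℝ and b_1, …, b_M : V → ℝ be linear maps (representing respectively the test-linear maps Φ ↦ k_m · a′_u(q(t_m), u(t_m))(δu(t_m), Φ) and Φ ↦ k_m · a′_q(q(t_m), u(t_m))(δq(t_m), Φ)), and let δu_0 ∈ U and δφ_0, …, δφ_M ∈ P be the tangent values. Then the following are equivalent: (i) for every test tuple (Φ_0, …, Φ_M) ∈ V^{M+1}: ∑_{m=1}^{M} [A_m(Φ_m) + γ χ_m ⟨δφ_m − δφ_{m−1}, Φ_{φ,m}⟩ + η ⟨δφ_m − δφ_{m−1}, Φ_{φ,m}⟩ + b_m(Φ_m)] + η₀ ⟨δu_0, Φ_{u,0}⟩ + η ⟨δφ_0,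 Φ_{φ,0}⟩ = 0 (the global tangent equation (27) with the dG(0) identification δφ⁺_{m−1} = δφ⁻_m inserted); (ii) δu_0 = 0, δφ_0 = 0, and for each m = 1, …, M and every Φ = (Φ_u, Φ_φ) ∈ V: γ χ_m ⟨δφ_m, Φ_φ⟩ + η ⟨δφ_m, Φ_φ⟩ + A_m(Φ) = γ χ_m ⟨δφ_{m−1}, Φ_φ⟩ + η ⟨δφ_{m−1}, Φ_φ⟩ − b_m(Φ). (This is the equivalence between the variational tangent equation and the forward tangent time-stepping scheme, including the homogeneous initial conditions.) -/
open RealInnerProductSpace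

/-- Summing `f m (Φ m)` over a tuple supported at the single index `k` isolates the `k`-th term. -/
theorem sum_apply_pi_single {ι V R : Type*} [DecidableEq ι] [Zero V] [AddCommMonoid R]
    (s : Finset ι) (f : ι → V → R) (hf : ∀ m, f m 0 = 0) (k : ι) (v : V) :
    ∑ m ∈ s, f m ((Pi.single k v : ι → V) m) = if k ∈ s then f k v else 0 := by
  rw [← Finset.sum_ite_eq s k fun m => f m v]
  refine Finset.sum_congr rfl fun m _ => ?_
  by_cases h : k = m
  · subst h
    simp
  · simp [h, hf]

/-- Equivalence of the global variational tangent equation (27) and the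
forward tangent time-stepping scheme with homogeneous initial conditions. -/
theorem stmt_5 (U P : Type*) [NormedAddCommGroup U] [InnerProductSpace ℝ U]
    [NormedAddCommGroup P] [InnerProductSpace ℝ P]
    (M : ℕ) (hM : 1 ≤ M) (γ : ℝ) (η η₀ : ℝ) (hη : 0 < η) (hη₀ : 0 < η₀)
    (χ : ℕ → ℝ)
    (A b : ℕ → (U × P) →ₗ[ℝ] ℝ)
    (δu0 : U) (δφ : ℕ → P) :
    (∀ Φ : ℕ → U × P,
      (∑ m ∈ Finset.Icc 1 M,
        (A m (Φ m)
          + γ * χ m * ⟪δφ m - δφ (m - 1), (Φ m).2⟫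
          + η * ⟪δφ m - δφ (m - 1), (Φ m).2⟫
          + b m (Φ m)))
        + η₀ * ⟪δu0, (Φ 0).1⟫ + η * ⟪δφ 0, (Φ 0).2⟫ = 0)
    ↔ (δu0 = 0 ∧ δφ 0 = 0 ∧
        ∀ m, 1 ≤ m → m ≤ M → ∀ Φ : U × P,
          γ * χ m * ⟪δφ m, Φ.2⟫ + η * ⟪δφ m, Φ.2⟫ + A m Φ
            = γ * χ m * ⟪δφ (m - 1), Φ.2⟫ + η * ⟪δφ (m - 1), Φ.2⟫ - b m Φ) := by
  have single (k : ℕ) (v : U × P) := sum_apply_pi_single (Finset.Icc 1 M)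
    (fun m v => A m v + γ * χ m * ⟪δφ m - δφ (m - 1), v.2⟫
      + η * ⟪δφ m - δφ (m - 1), v.2⟫ + b m v) (by simp) k v
  constructor
  · intro h
    refine ⟨?_, ?_, fun m hm hmM v => ?_⟩
    · have h0 := h (Pi.single 0 (δu0, 0))
      rw [single] at h0
      simpa [hη₀.ne'] using h0
    · have h0 := h (Pi.single 0 (0, δφ 0))
      rw [single] at h0
      simpa [hη.ne'] using h0
    · have h0 := h (Pi.single m v)
      rw [single, if_pos (Finset.mem_Icc.2 ⟨hm, hmM⟩),
        Pi.single_eq_of_ne (by omega : 0 ≠ m)] at h0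
      simp only [inner_sub_left, Prod.fst_zero, Prod.snd_zero, inner_zero_right] at h0
      linarith
  · rintro ⟨hu, hφ, h⟩ Φ
    rw [Finset.sum_eq_zero, hu, hφ]
    · simp
    · intro m hm
      obtain ⟨hm, hmM⟩ := Finset.mem_Icc.1 hm
      have h0 := h m hm hmM (Φ m)
      simp only [inner_sub_left]
      linarith
end
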